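/- Let p be a cop-SOS convex polynomial in n variables, meaning ∇²p(x) = P_0(x)P_0(x)ᵀ + Σ_{i=1}^n x_i·P_i(x)P_i(x)ᵀ for some matrix polynomials P_i. Let L : ℝ[x] → ℝ be a linear functional such that L(1) = 1, L(σ) ≥ 0 for every sum-of-squares polynomial σ of degree at most 2k, and L(x_i·σ) ≥ 0 for every i and every SOS polynomial σ of degree at most 2k−2, where 2k ≥ deg(p). Set u = (L(x_1), ..., L(x_n)). Then p(u) ≤ L(p). -/

import Mathlib

open MvPolynomial Matrix

/-- A polynomial is a sum of squares (SOS). -/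
def IsSOS {n : ℕ} (σ : MvPolynomial (Fin n) ℝ) : Prop :=
  ∃ l : List (MvPolynomial (Fin n) ℝ), σ = (l.map (fun q => q ^ 2)).sum

/-- A polynomial `p` is cop-SOS convex if its Hessian has a decomposition
`∇²p(x) = P₀(x)P₀(x)ᵀ + ∑ᵢ xᵢ·Pᵢ(x)Pᵢ(x)ᵀ` for matrix polynomials `Pᵢ`. -/
def CopSOSConvex {n : ℕ} (p : MvPolynomial (Fin n) ℝ) : Prop :=
  ∃ (r : ℕ) (P0 : Matrix (Fin n) (Fin r) (MvPolynomial (Fin n) ℝ))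
    (P : Fin n → Matrix (Fin n) (Fin r) (MvPolynomial (Fin n) ℝ)),
    ∀ (x : Fin n → ℝ) (i j : Fin n),
      eval x (pderiv i (pderiv j p)) =
        ((P0.map (eval x)) * (P0.map (eval x))ᵀ
          + ∑ l, x l • ((P l).map (eval x) * ((P l).map (eval x))ᵀ)) i j

section Helpers

/-- Nonnegative leading coefficients do not cancel. -/
lemma lead_add {n : ℕ} (f g : MvPolynomial (Fin n) ℝ)
    (hf : 0 ≤ MonomialOrder.degLex.leadingCoeff f)
    (hg : 0 ≤ MonomialOrder.degLex.leadingCoeff g) :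
    0 ≤ MonomialOrder.degLex.leadingCoeff (f + g) ∧ f.totalDegree ≤ (f + g).totalDegree := by
  set m : MonomialOrder (Fin n) := MonomialOrder.degLex with hm
  by_cases hf0 : f = 0
  · subst hf0; simpa using hg
  by_cases hg0 : g = 0
  · subst hg0; simpa using hf
  have hf' : 0 < m.leadingCoeff f :=
    lt_of_le_of_ne hf (Ne.symm (mt m.leadingCoeff_eq_zero_iff.mp hf0))
  have hg' : 0 < m.leadingCoeff g :=
    lt_of_le_of_ne hg (Ne.symm (mt m.leadingCoeff_eq_zero_iff.mp hg0))
  rcases lt_trichotomy (m.toSyn (m.degree f)) (m.toSyn (m.degree g)) with h | h | h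
  · have hd := m.degree_add_eq_right_of_lt h
    refine ⟨?_, ?_⟩
    · rw [add_comm, m.leadingCoeff_add_of_lt h]; exact hg
    · apply degLex_totalDegree_monotone
      rw [← hm, hd]; exact h.le
  · have h' : m.degree f = m.degree g := m.toSyn.injective h
    have hc : 0 < (f + g).coeff (m.degree f) := by
      rw [coeff_add]
      have h2 : g.coeff (m.degree f) = m.leadingCoeff g := by rw [h']; rfl
      rw [h2]
      exact add_pos hf' hg'
    have hle : m.toSyn (m.degree f) ≤ m.toSyn (m.degree (f + g)) :=
      m.le_degree (mem_support_iff.mpr hc.ne')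
    have hge : m.toSyn (m.degree (f + g)) ≤ m.toSyn (m.degree f) := by
      refine m.degree_add_le.trans ?_
      rw [h]; simp
    have he : m.degree (f + g) = m.degree f := m.toSyn.injective (le_antisymm hge hle)
    refine ⟨?_, ?_⟩
    · unfold MonomialOrder.leadingCoeff
      rw [he]; exact hc.le
    · apply degLex_totalDegree_monotone
      rw [← hm]; exact hle
  · have hd := m.degree_add_of_lt h
    refine ⟨?_, ?_⟩
    · rw [m.leadingCoeff_add_of_lt h]; exact hf
    · apply degLex_totalDegree_monotone
      rw [← hm, hd]

lemma lead_sum {n : ℕ} {ι : Type*} (s : Finset ι) (f : ι → MvPolynomial (Fin n) ℝ)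
    (hf : ∀ i ∈ s, 0 ≤ MonomialOrder.degLex.leadingCoeff (f i)) :
    0 ≤ MonomialOrder.degLex.leadingCoeff (∑ i ∈ s, f i) ∧
      ∀ i ∈ s, (f i).totalDegree ≤ (∑ i ∈ s, f i).totalDegree := by
  classical
  induction s using Finset.induction_on with
  | empty => simp
  | insert a s ha ih =>
    obtain ⟨h1, h2⟩ := ih (fun i hi => hf i (Finset.mem_insert_of_mem hi))
    have h3 := hf a (Finset.mem_insert_self a s)
    rw [Finset.sum_insert ha]
    refine ⟨(lead_add _ _ h3 h1).1, ?_⟩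
    intro i hi
    rcases Finset.mem_insert.mp hi with rfl | hi
    · exact (lead_add _ _ h3 h1).2
    · rw [add_comm]
      exact (h2 i hi).trans (lead_add _ _ h1 h3).2

lemma lead_sq {n : ℕ} (q : MvPolynomial (Fin n) ℝ) :
    0 ≤ MonomialOrder.degLex.leadingCoeff (q * q) := by
  rw [MonomialOrder.leadingCoeff_mul]; exact mul_self_nonneg _

lemma lead_X_mul {n : ℕ} (i : Fin n) (q : MvPolynomial (Fin n) ℝ)
    (hq : 0 ≤ MonomialOrder.degLex.leadingCoeff q) :
    0 ≤ MonomialOrder.degLex.leadingCoeff (X i * q) := by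
  rw [MonomialOrder.leadingCoeff_mul, MonomialOrder.leadingCoeff_X, one_mul]; exact hq

lemma deg_pderiv {n : ℕ} (i : Fin n) (p : MvPolynomial (Fin n) ℝ) :
    (pderiv i p).totalDegree ≤ p.totalDegree - 1 := by
  conv_lhs => rw [p.as_sum, map_sum]
  refine totalDegree_finsetSum_le ?_
  intro m hm
  rw [pderiv_monomial]
  by_cases h0 : m i = 0
  · simp [h0]
  refine (totalDegree_monomial_le _ _).trans ?_
  have h1 := le_totalDegree hm
  have h2 : (m - Finsupp.single i 1) + Finsupp.single i 1 = m := by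
    apply tsub_add_cancel_of_le
    rw [Finsupp.single_le_iff]; omega
  have h3 : ((m - Finsupp.single i 1) + Finsupp.single i 1).degree = m.degree := by rw [h2]
  rw [map_add, Finsupp.degree_single] at h3
  change (m - Finsupp.single i 1).degree ≤ _
  change m.degree ≤ _ at h1
  omega

/-- The substitution `x ↦ u + t (x - u)`. -/
noncomputable def phi {n : ℕ} (u : Fin n → ℝ) (t : ℝ) :
    MvPolynomial (Fin n) ℝ →ₐ[ℝ] MvPolynomial (Fin n) ℝ :=
  aeval (fun i => C (u i) + C t * (X i - C (u i)))

lemma phi_X {n : ℕ} (u : Fin n → ℝ) (t : ℝ) (i : Fin n) :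
    phi u t (X i) = C (u i) + C t * (X i - C (u i)) := by
  simp [phi]

lemma phi_C {n : ℕ} (u : Fin n → ℝ) (t : ℝ) (c : ℝ) :
    phi u t (C c) = C c := by
  simp [phi]

lemma deg_X_sub {n : ℕ} (u : Fin n → ℝ) (i : Fin n) :
    (X i - C (u i) : MvPolynomial (Fin n) ℝ).totalDegree ≤ 1 := by
  refine (totalDegree_sub _ _).trans ?_
  simp

lemma deg_phi {n : ℕ} (u : Fin n → ℝ) (t : ℝ) (q : MvPolynomial (Fin n) ℝ) :
    (phi u t q).totalDegree ≤ q.totalDegree := by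
  have hX : ∀ i, (C (u i) + C t * (X i - C (u i)) : MvPolynomial (Fin n) ℝ).totalDegree ≤ 1 := by
    intro i
    refine (totalDegree_add _ _).trans (max_le (by simp) ?_)
    refine (totalDegree_mul _ _).trans ?_
    have := deg_X_sub u i
    simpa using this
  unfold phi
  rw [aeval_def, eval₂_eq']
  refine totalDegree_finsetSum_le ?_
  intro m hm
  refine (totalDegree_mul _ _).trans ?_
  have h1 := le_totalDegree hm
  have h2 : (∏ i, (C (u i) + C t * (X i - C (u i)) : MvPolynomial (Fin n) ℝ) ^ m i).totalDegree
      ≤ ∑ i, m i := by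
    refine (totalDegree_finsetProd _ _).trans (Finset.sum_le_sum ?_)
    intro i _
    refine (totalDegree_pow _ _).trans ?_
    calc _ ≤ m i * 1 := Nat.mul_le_mul_left _ (hX i)
      _ = m i := mul_one _
  have h3 : (m.sum fun _ e => e) = ∑ i, m i := Finsupp.sum_fintype _ _ (by simp)
  rw [h3] at h1
  have h4 : (algebraMap ℝ (MvPolynomial (Fin n) ℝ) (coeff m q)).totalDegree = 0 :=
    totalDegree_C _
  omega

lemma phi_one {n : ℕ} (u : Fin n → ℝ) (q : MvPolynomial (Fin n) ℝ) : phi u 1 q = q := by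
  have : phi u 1 = AlgHom.id ℝ _ := by
    apply MvPolynomial.algHom_ext
    intro i
    rw [phi_X]; simp
  rw [this]; rfl

lemma phi_zero {n : ℕ} (u : Fin n → ℝ) (q : MvPolynomial (Fin n) ℝ) :
    phi u 0 q = C (eval u q) := by
  induction q using MvPolynomial.induction_on with
  | C a => simp
  | add p q hp hq => simp [hp, hq]
  | mul_X p i hp => simp [hp, phi_X]

lemma L_C_mul {n : ℕ} (L : MvPolynomial (Fin n) ℝ →ₗ[ℝ] ℝ) (c : ℝ)
    (q : MvPolynomial (Fin n) ℝ) : L (C c * q) = c * L q := by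
  rw [← smul_eq_C_mul, map_smul, smul_eq_mul]

lemma deriv_phi {n : ℕ} (L : MvPolynomial (Fin n) ℝ →ₗ[ℝ] ℝ) (u : Fin n → ℝ) (t : ℝ)
    (q : MvPolynomial (Fin n) ℝ) : ∀ s : MvPolynomial (Fin n) ℝ,
    HasDerivAt (fun t => L (s * phi u t q))
      (L (s * ∑ i, (X i - C (u i)) * phi u t (pderiv i q))) t := by
  induction q using MvPolynomial.induction_on with
  | C a => intro s; simpa [phi_C] using hasDerivAt_const t _
  | add p q hp hq =>
    intro s
    have := (hp s).add (hq s)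
    refine (this.congr_deriv ?_).congr_of_eventuallyEq (.of_forall fun t => ?_)
    rotate_left
    · simp [mul_add]
    · rw [← map_add, ← mul_add, ← Finset.sum_add_distrib]
      simp [mul_add]
  | mul_X p j hp =>
    intro s
    have h1 := (hp (s * C (u j)))
    have h2 := (hasDerivAt_id t).mul (hp (s * (X j - C (u j))))
    have := h1.add h2
    refine (this.congr_deriv ?_).congr_of_eventuallyEq (.of_forall fun t => ?_)
    rotate_left
    · simp only [Pi.add_apply, Pi.mul_apply, id]
      rw [← L_C_mul, ← map_add]
      congr 1
      rw [map_mul, phi_X]; ring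
    · simp only [id]
      rw [one_mul, ← L_C_mul, ← map_add, ← map_add]
      symm
      congr 1
      have h3 : ∀ i, (X i - C (u i)) * phi u t (pderiv i (p * X j)) =
          (if i = j then (X j - C (u j)) * phi u t p else 0) +
          ((X i - C (u i)) * phi u t (pderiv i p)) * (C (u j) + C t * (X j - C (u j))) := by
        intro i
        rw [pderiv_mul, map_add, map_mul, map_mul, phi_X]
        by_cases h : i = j
        · subst h; simp; ring
        · rw [pderiv_X_of_ne (Ne.symm h)]; simp [h]; ring
      rw [Finset.sum_congr rfl (fun i _ => h3 i), Finset.sum_add_distrib, ← Finset.sum_mul]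
      simp
      ring

lemma second_order (g g1 g2 : ℝ → ℝ) (h : ∀ t, HasDerivAt g (g1 t) t)
    (h1 : ∀ t, HasDerivAt g1 (g2 t) t) (h0 : g1 0 = 0)
    (h2 : ∀ t, 0 ≤ t → t ≤ 1 → 0 ≤ g2 t) : g 0 ≤ g 1 := by
  have key : ∀ f f' : ℝ → ℝ, (∀ t, HasDerivAt f (f' t) t) →
      (∀ t, 0 ≤ t → t ≤ 1 → 0 ≤ f' t) → MonotoneOn f (Set.Icc 0 1) := by
    intro f f' hf hf'
    refine monotoneOn_of_deriv_nonneg (convex_Icc 0 1)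
      (fun t _ => (hf t).continuousAt.continuousWithinAt)
      (fun t _ => (hf t).differentiableAt.differentiableWithinAt) ?_
    intro t ht
    have := interior_subset ht
    rw [(hf t).deriv]
    exact hf' t this.1 this.2
  have m1 := key g1 g2 h1 h2
  have m0 := key g g1 h (fun t ht0 ht1 => by
    rw [← h0]
    exact m1 (by simp) ⟨ht0, ht1⟩ ht0)
  exact m0 (by simp) (by simp) zero_le_one

lemma isSOS_sum_sq {n r : ℕ} (f : Fin r → MvPolynomial (Fin n) ℝ) :
    IsSOS (∑ j, f j ^ 2) :=
  ⟨List.ofFn f, by simp [List.map_ofFn, List.sum_ofFn]⟩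

lemma deg_comb {n : ℕ} (u : Fin n → ℝ) (t : ℝ) (q : Fin n → MvPolynomial (Fin n) ℝ) (d : ℕ)
    (hq : ∀ i, q i = 0 ∨ (q i).totalDegree + 1 ≤ d) :
    ((∑ i, (X i - C (u i)) * phi u t (q i)) ^ 2).totalDegree ≤ 2 * d := by
  refine (totalDegree_pow _ _).trans (Nat.mul_le_mul_left _ ?_)
  refine totalDegree_finsetSum_le ?_
  intro i _
  rcases hq i with h | h
  · simp [h]
  · refine (totalDegree_mul _ _).trans ?_
    have h1 := deg_X_sub u i
    have h2 := deg_phi u t (q i)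
    omega

lemma sum_sq_expand {n r : ℕ} (y : Fin n → MvPolynomial (Fin n) ℝ)
    (A : Fin n → Fin r → MvPolynomial (Fin n) ℝ) :
    ∑ i, ∑ j, y i * y j * ∑ a, A i a * A j a = ∑ a, (∑ i, y i * A i a) ^ 2 := by
  have : ∀ a, (∑ i, y i * A i a) ^ 2 = ∑ i, ∑ j, y i * y j * (A i a * A j a) := by
    intro a
    rw [sq, Finset.sum_mul_sum]
    refine Finset.sum_congr rfl fun i _ => Finset.sum_congr rfl fun j _ => by ring
  simp_rw [this, Finset.mul_sum]
  rw [Finset.sum_comm]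
  rw [Finset.sum_comm]
  conv_rhs => rw [Finset.sum_comm]
  refine Finset.sum_congr rfl fun i _ => ?_
  rw [Finset.sum_comm]

lemma hess_expand {n : ℕ} (p : MvPolynomial (Fin n) ℝ) (r : ℕ)
    (P0 : Matrix (Fin n) (Fin r) (MvPolynomial (Fin n) ℝ))
    (P : Fin n → Matrix (Fin n) (Fin r) (MvPolynomial (Fin n) ℝ)) (u : Fin n → ℝ) (t : ℝ)
    (H : ∀ i j, pderiv i (pderiv j p) =
      (∑ a, P0 i a * P0 j a) + ∑ l, X l * ∑ a, P l i a * P l j a) :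
    ∑ i, (X i - C (u i)) * ∑ j, (X j - C (u j)) * phi u t (pderiv j (pderiv i p))
      = (∑ a, (∑ i, (X i - C (u i)) * phi u t (P0 i a)) ^ 2) +
        ∑ l, (C ((1 - t) * u l) * (∑ a, (∑ i, (X i - C (u i)) * phi u t (P l i a)) ^ 2)
          + C t * (X l * (∑ a, (∑ i, (X i - C (u i)) * phi u t (P l i a)) ^ 2))) := by
  have e : ∀ l (S : MvPolynomial (Fin n) ℝ),
      C ((1 - t) * u l) * S + C t * (X l * S) = phi u t (X l) * S := by
    intro l S
    rw [phi_X, map_mul, map_sub, map_one]; ring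
  have hphi : ∀ i j, phi u t (pderiv j (pderiv i p)) =
      (∑ a, phi u t (P0 i a) * phi u t (P0 j a)) +
        ∑ l, phi u t (X l) * ∑ a, phi u t (P l i a) * phi u t (P l j a) := by
    intro i j
    rw [H j i, map_add, map_sum, map_sum]
    congr 1
    · exact Finset.sum_congr rfl fun a _ => by rw [map_mul, mul_comm]
    · refine Finset.sum_congr rfl fun l _ => ?_
      rw [map_mul, map_sum]
      congr 1
      exact Finset.sum_congr rfl fun a _ => by rw [map_mul, mul_comm]
  simp_rw [e, hphi]
  generalize (phi u t : MvPolynomial (Fin n) ℝ → MvPolynomial (Fin n) ℝ) = f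
  generalize hy : (fun i => X i - C (u i) : Fin n → MvPolynomial (Fin n) ℝ) = y
  have hy' : ∀ i, (X i - C (u i) : MvPolynomial (Fin n) ℝ) = y i := fun i => by rw [← hy]
  simp_rw [hy']
  rw [← sum_sq_expand y (fun i a => f (P0 i a))]
  have h2 : ∀ l, ∑ a, (∑ i, y i * f (P l i a)) ^ 2 = _ :=
    fun l => (sum_sq_expand y (fun i a => f (P l i a))).symm
  simp_rw [h2]
  have h3 : ∀ l, f (X l) * ∑ i, ∑ j, y i * y j * ∑ a, f (P l i a) * f (P l j a) =
      ∑ i, ∑ j, y i * y j * (f (X l) * ∑ a, f (P l i a) * f (P l j a)) := by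
    intro l
    rw [Finset.mul_sum]
    refine Finset.sum_congr rfl fun i _ => ?_
    rw [Finset.mul_sum]
    exact Finset.sum_congr rfl fun j _ => by ring
  simp_rw [h3]
  rw [Finset.sum_comm (γ := Fin n) (s := Finset.univ (α := Fin n)) (t := Finset.univ (α := Fin n))
    (f := fun l i => ∑ j, y i * y j * (f (X l) * ∑ a, f (P l i a) * f (P l j a))),
    ← Finset.sum_add_distrib]
  refine Finset.sum_congr rfl fun i _ => ?_
  rw [Finset.sum_comm (f := fun l j => y i * y j * (f (X l) * ∑ a, f (P l i a) * f (P l j a))),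
    ← Finset.sum_add_distrib, Finset.mul_sum]
  refine Finset.sum_congr rfl fun j _ => ?_
  rw [← Finset.mul_sum]
  ring

end Helpers

/-- The copositive Jensen inequality (Lemma 4.3): if `p` is cop-SOS convex of
degree at most `2k` and `L` is a unital linear functional nonnegative on
SOS polynomials of degree ≤ 2k and on `xᵢ·σ` for SOS `σ` of degree ≤ 2k−2,
then `p(u) ≤ L(p)` for `u = (L(x₁),…,L(x_n))`. -/
theorem stmt8 (n k : ℕ) (p : MvPolynomial (Fin n) ℝ)
    (hp : CopSOSConvex p) (hdeg : p.totalDegree ≤ 2 * k)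
    (L : MvPolynomial (Fin n) ℝ →ₗ[ℝ] ℝ)
    (hL1 : L 1 = 1)
    (hLsos : ∀ σ : MvPolynomial (Fin n) ℝ,
      IsSOS σ → σ.totalDegree ≤ 2 * k → 0 ≤ L σ)
    (hLloc : ∀ (i : Fin n) (σ : MvPolynomial (Fin n) ℝ),
      IsSOS σ → σ.totalDegree ≤ 2 * k - 2 → 0 ≤ L (X i * σ)) :
    eval (fun i => L (X i)) p ≤ L p := by
  obtain ⟨r, P0, P, hH⟩ := hp
  set u : Fin n → ℝ := fun i => L (X i) with hu
  have hLC : ∀ c, L (C c) = c := by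
    intro c
    have := L_C_mul L c 1
    rwa [mul_one, hL1, mul_one] at this
  rcases Nat.eq_zero_or_pos k with hk | hk
  · subst hk
    have h0 : p.totalDegree = 0 := by omega
    rw [totalDegree_eq_zero_iff_eq_C] at h0
    rw [h0, hLC, eval_C]
  have hunn : ∀ i, 0 ≤ u i := by
    intro i
    have := hLloc i 1 ⟨[1], by simp⟩ (by simp)
    simpa using this
  have H : ∀ i j, pderiv i (pderiv j p) =
      (∑ a, P0 i a * P0 j a) + ∑ l, X l * ∑ a, P l i a * P l j a := by
    intro i j
    apply MvPolynomial.funext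
    intro x
    rw [hH x i j]
    simp [Matrix.mul_apply, Matrix.sum_apply]
  -- degree bounds
  have hbd : ∀ i, (∀ a, (P0 i a * P0 i a).totalDegree ≤ 2 * k - 2) ∧
      ∀ l a, (X l * (P l i a * P l i a)).totalDegree ≤ 2 * k - 2 := by
    intro i
    have hd : (pderiv i (pderiv i p)).totalDegree ≤ 2 * k - 2 := by
      have h1 := deg_pderiv i (pderiv i p)
      have h2 := deg_pderiv i p
      omega
    rw [H i i] at hd
    simp_rw [Finset.mul_sum] at hd
    have hA := lead_sum Finset.univ (fun a => P0 i a * P0 i a) (fun a _ => lead_sq _)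
    have hB := fun l => lead_sum Finset.univ (fun a => X l * (P l i a * P l i a))
      (fun a _ => lead_X_mul l _ (lead_sq _))
    have hD := lead_sum Finset.univ (fun l => ∑ a, X l * (P l i a * P l i a))
      (fun l _ => (hB l).1)
    refine ⟨fun a => ?_, fun l a => ?_⟩
    · exact ((hA.2 a (Finset.mem_univ a)).trans (lead_add _ _ hA.1 hD.1).2).trans hd
    · have h1 := (lead_add _ _ hD.1 hA.1).2
      rw [add_comm] at h1
      exact ((((hB l).2 a (Finset.mem_univ a)).trans (hD.2 l (Finset.mem_univ l))).trans h1).trans hd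
  have hdP0 : ∀ a i, P0 i a = 0 ∨ (P0 i a).totalDegree + 1 ≤ k := by
    intro a i
    by_cases h : P0 i a = 0
    · exact Or.inl h
    · right
      have h1 := (hbd i).1 a
      rw [totalDegree_mul_of_isDomain h h] at h1
      omega
  have hdP : ∀ l a i, P l i a = 0 ∨ (P l i a).totalDegree + 1 ≤ k - 1 := by
    intro l a i
    by_cases h : P l i a = 0
    · exact Or.inl h
    · right
      have h1 := (hbd i).2 l a
      rw [totalDegree_mul_of_isDomain (X_ne_zero l) (mul_ne_zero h h),
        totalDegree_mul_of_isDomain h h, totalDegree_X] at h1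
      omega
  have hmain := second_order (fun t => L (1 * phi u t p))
    (fun t => L (1 * ∑ i, (X i - C (u i)) * phi u t (pderiv i p)))
    (fun t => ∑ i, L ((X i - C (u i)) * ∑ j, (X j - C (u j)) * phi u t (pderiv j (pderiv i p))))
    (fun t => deriv_phi L u t p 1) ?_ ?_ ?_
  · simpa [phi_zero, phi_one, hLC] using hmain
  · intro t
    have h1 := HasDerivAt.fun_sum (u := Finset.univ) (x := t)
      (fun i _ => deriv_phi L u t (pderiv i p) (X i - C (u i)))
    refine h1.congr_of_eventuallyEq (.of_forall fun t => ?_)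
    simp
  · simp only [phi_zero, one_mul, map_sum]
    refine Finset.sum_eq_zero fun i _ => ?_
    rw [mul_comm, L_C_mul, map_sub, hLC]
    simp [hu]
  · intro t ht0 ht1
    rw [← map_sum]
    have hexp := hess_expand p r P0 P u t H
    rw [hexp, map_add]
    have hdegl : ∀ l, (∑ a, (∑ i, (X i - C (u i)) * phi u t (P l i a)) ^ 2).totalDegree
        ≤ 2 * k - 2 := by
      intro l
      refine totalDegree_finsetSum_le fun a _ => ?_
      have := deg_comb u t (fun i => P l i a) (k - 1) (hdP l a)
      omega
    have hterm : ∀ l, 0 ≤ L (C ((1 - t) * u l) * (∑ a, (∑ i, (X i - C (u i)) * phi u t (P l i a)) ^ 2)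
            + C t * (X l * (∑ a, (∑ i, (X i - C (u i)) * phi u t (P l i a)) ^ 2))) := by
      intro l
      rw [map_add, L_C_mul, L_C_mul]
      have h1 := hLsos _ (isSOS_sum_sq _) ((hdegl l).trans (Nat.sub_le _ _))
      have h2 := hLloc l _ (isSOS_sum_sq _) (hdegl l)
      have h3 : 0 ≤ (1 - t) * u l := mul_nonneg (by linarith) (hunn l)
      exact add_nonneg (mul_nonneg h3 h1) (mul_nonneg ht0 h2)
    refine add_nonneg ?_ (by rw [map_sum]; refine Finset.sum_nonneg fun l _ => ?_; exact hterm l)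
    · refine hLsos _ (isSOS_sum_sq _) (totalDegree_finsetSum_le fun a _ => ?_)
      exact deg_comb u t (fun i => P0 i a) k (hdP0 a)
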